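/- Let P ⊂ A be an inclusion of simple unital C*-algebras (a C*-algebra is simple if its only closed two-sided ideals are {0} and the whole algebra) and E : A → P a conditional expectation admitting a quasi-basis, with Watatani index Index E = λ·1_A for a real number λ with λ < 4. Then the inclusion P ⊂ A is irreducible: the relative commutant P' ∩ A = { x ∈ A : x p = p x for all p ∈ P } equals ℂ·1_A. -/

import Mathlib

/-- In a (topologically) simple complex Banach algebra the center is trivial. -/
theorem central_scalar_aux {B : Type*} [NormedRing B] [NormedAlgebra ℂ B] [CompleteSpace B]
    [Nontrivial B]
    (hs : ∀ I : TwoSidedIdeal B, IsClosed (I : Set B) → I = ⊥ ∨ I = ⊤)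
    (z : B) (hz : ∀ x, z * x = x * z) : ∃ c : ℂ, z = c • (1 : B) := by
  obtain ⟨c, hc⟩ := spectrum.nonempty z
  refine ⟨c, ?_⟩
  set w : B := algebraMap ℂ B c - z with hw
  have hnu : ¬ IsUnit w := hc
  have hwc : ∀ x, w * x = x * w := by
    intro x
    rw [hw, sub_mul, mul_sub, hz x, Algebra.commutes]
  let S : Set B := Set.range (fun a => w * a)
  have hadd : ∀ {x y}, x ∈ closure S → y ∈ closure S → x + y ∈ closure S := by
    intro x y hx hy
    refine map_mem_closure₂ continuous_add hx hy ?_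
    rintro _ ⟨a, rfl⟩ _ ⟨b, rfl⟩
    exact ⟨a + b, mul_add _ _ _⟩
  have hneg : ∀ {x}, x ∈ closure S → -x ∈ closure S := by
    intro x hx
    refine map_mem_closure continuous_neg hx ?_
    rintro _ ⟨a, rfl⟩
    exact ⟨-a, mul_neg _ _⟩
  have hl : ∀ {x y}, y ∈ closure S → x * y ∈ closure S := by
    intro x y hy
    refine map_mem_closure (continuous_const_mul x) hy ?_
    rintro _ ⟨a, rfl⟩
    exact ⟨x * a, by simp only [← mul_assoc, hwc]⟩
  have hr : ∀ {x y}, x ∈ closure S → x * y ∈ closure S := by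
    intro x y hx
    refine map_mem_closure (f := fun t => t * y) (continuous_mul_const y) hx ?_
    rintro _ ⟨a, rfl⟩
    exact ⟨a * y, by simp only [mul_assoc]⟩
  let I : TwoSidedIdeal B := TwoSidedIdeal.mk' (closure S)
    (subset_closure ⟨0, mul_zero _⟩) hadd hneg hl hr
  have hI : (I : Set B) = closure S := by
    ext x
    exact TwoSidedIdeal.mem_mk' _ _ _ _ _ _ x
  rcases hs I (hI ▸ isClosed_closure) with h | h
  · have : w ∈ I := by
      change w ∈ (I : Set B)
      rw [hI]
      exact subset_closure ⟨1, mul_one _⟩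
    rw [h, TwoSidedIdeal.mem_bot] at this
    rw [hw, sub_eq_zero] at this
    rw [← this, Algebra.algebraMap_eq_smul_one]
  · exfalso
    have : (1 : B) ∈ closure S := by
      rw [← hI, h]; trivial
    obtain ⟨_, ⟨a, rfl⟩, ha⟩ := Metric.mem_closure_iff.1 this 1 one_pos
    rw [dist_eq_norm] at ha
    have h1 := isUnit_one_sub_of_norm_lt_one ha
    rw [sub_sub_cancel] at h1
    exact hnu ((Commute.isUnit_mul_iff (hwc a)).1 h1).1

theorem map_star_aux {A : Type*} [CStarAlgebra A] [PartialOrder A] [StarOrderedRing A]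
    (E : A →ₗ[ℂ] A) (hE : ∀ x, 0 ≤ x → 0 ≤ E x) (x : A) : E (star x) = star (E x) := by
  obtain ⟨y, hy, -, h⟩ := CStarAlgebra.exists_sum_four_nonneg x
  rw [h]
  simp only [star_sum, map_sum, map_smul, star_smul]
  refine Finset.sum_congr rfl fun i _ => ?_
  rw [(IsSelfAdjoint.of_nonneg (hy i)).star_eq, (IsSelfAdjoint.of_nonneg (hE _ (hy i))).star_eq]

/-- The basic inequality. -/
theorem key_ineq_aux {A : Type*} [CStarAlgebra A] [PartialOrder A] [StarOrderedRing A]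
    (P : StarSubalgebra ℂ A)
    (E : A →ₗ[ℂ] A)
    (hrange : ∀ x : A, E x ∈ P)
    (hmod : ∀ p ∈ P, ∀ x : A, E (p * x) = p * E x ∧ E (x * p) = E x * p)
    (hstar : ∀ x, E (star x) = star (E x))
    (hCP : ∀ (k : ℕ) (a b : Fin k → A),
      0 ≤ ∑ i, ∑ j, star (b i) * E (star (a i) * a j) * b j)
    {m : ℕ} (u v : Fin m → A)
    (hqb : ∀ a : A, (∑ i, u i * E (v i * a) = a) ∧ (∑ i, E (a * u i) * v i = a))
    (f : A) (hf : star f = f) (hfc : ∀ p ∈ P, f * p = p * f) :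
    0 ≤ E (f * f) - f * f + (1 / 4 : ℂ) • ∑ i, u i * (f * f) * v i := by
  have h1 : ∀ i, ∑ j, E (v i * star (v j)) * star (u j) = v i := by
    intro i
    have := congrArg star (hqb (star (v i))).1
    simpa [star_sum, ← hstar] using this
  have h2 : ∀ i, ∑ j, E (v i * star (v j)) * E (star (u j) * f) = E (v i * f) := by
    intro i
    conv_rhs => rw [← h1 i, Finset.sum_mul, map_sum]
    refine Finset.sum_congr rfl fun j _ => ?_
    rw [mul_assoc, (hmod _ (hrange _) _).1]
  have h3 : ∀ i, ∑ j, E (v i * star (v j)) * (f * star (u j)) = f * v i := by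
    intro i
    conv_rhs => rw [← h1 i, Finset.mul_sum]
    refine Finset.sum_congr rfl fun j _ => ?_
    rw [← mul_assoc, ← mul_assoc, hfc _ (hrange _)]
  have h4 : ∑ i, E (f * u i) * E (v i * f) = E (f * f) := by
    conv_rhs => rw [← (hqb f).1, Finset.mul_sum, map_sum]
    refine Finset.sum_congr rfl fun j _ => ?_
    rw [(hqb f).1, ← mul_assoc, (hmod _ (hrange _) _).2]
  have h5 : ∑ i, E (f * u i) * (f * v i) = f * f := by
    conv_rhs => rw [← (hqb f).2, Finset.mul_sum]
    refine Finset.sum_congr rfl fun j _ => ?_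
    rw [(hqb f).2, ← mul_assoc, ← mul_assoc, hfc _ (hrange _)]
  have h6 : ∑ i, u i * f * E (v i * f) = f * f := by
    conv_rhs => rw [← (hqb f).1, Finset.sum_mul]
    refine Finset.sum_congr rfl fun j _ => ?_
    rw [(hqb f).1, mul_assoc, mul_assoc, hfc _ (hrange _)]
  have key := hCP m (fun i => star (v i))
    (fun i => E (star (u i) * f) - (1 / 2 : ℂ) • (f * star (u i)))
  have hin : ∀ i, ∑ j, E (v i * star (v j)) * (E (star (u j) * f) - (1 / 2 : ℂ) • (f * star (u j)))
      = E (v i * f) - (1 / 2 : ℂ) • (f * v i) := by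
    intro i
    simp only [mul_sub, Finset.sum_sub_distrib, mul_smul_comm, ← Finset.smul_sum, h2, h3]
  have hsb : ∀ i, star (E (star (u i) * f) - (1 / 2 : ℂ) • (f * star (u i)))
      = E (f * u i) - (1 / 2 : ℂ) • (u i * f) := by
    intro i
    have : star (1 / 2 : ℂ) = 1 / 2 := by simp
    rw [star_sub, star_smul, ← hstar, this]
    simp [hf]
  simp only [star_star, mul_assoc, ← Finset.mul_sum, hin, hsb] at key
  convert key using 1
  simp only [sub_mul, mul_sub, Finset.sum_sub_distrib, mul_smul_comm, smul_mul_assoc,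
    ← Finset.smul_sum, h4, h5, h6]
  have h7 : ∑ i, u i * f * (f * v i) = ∑ i, u i * (f * f) * v i := by
    simp only [mul_assoc]
  rw [h7]
  module

/-- The dual functional takes values in the center. -/
theorem dual_central_aux {A : Type*} [CStarAlgebra A]
    (P : StarSubalgebra ℂ A)
    (E : A →ₗ[ℂ] A)
    (hrange : ∀ x : A, E x ∈ P)
    {m : ℕ} (u v : Fin m → A)
    (hqb : ∀ a : A, (∑ i, u i * E (v i * a) = a) ∧ (∑ i, E (a * u i) * v i = a))
    (x : A) (hx : ∀ p ∈ P, x * p = p * x) (a : A) :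
    (∑ i, u i * x * v i) * a = a * ∑ i, u i * x * v i := by
  have e1 : a * ∑ i, u i * x * v i = ∑ i, ∑ j, u j * x * (E (v j * a * u i) * v i) := by
    rw [Finset.mul_sum]
    refine Finset.sum_congr rfl fun i _ => ?_
    have : a * (u i * x * v i) = (a * u i) * (x * v i) := by simp only [mul_assoc]
    rw [this]
    conv_lhs => rw [← (hqb (a * u i)).1, Finset.sum_mul]
    refine Finset.sum_congr rfl fun j _ => ?_
    have h := hx _ (hrange (v j * a * u i))
    calc u j * E (v j * (a * u i)) * (x * v i)
        = u j * (E (v j * a * u i) * x) * v i := by simp only [mul_assoc]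
      _ = _ := by rw [← h]; simp only [mul_assoc]
  rw [e1, Finset.sum_comm, Finset.sum_mul]
  refine Finset.sum_congr rfl fun j _ => ?_
  rw [← Finset.mul_sum, (hqb (v j * a)).2, mul_assoc]

theorem real_scalar_aux {A : Type*} [CStarAlgebra A] [Nontrivial A] (z : ℂ)
    (h : IsSelfAdjoint (z • (1 : A))) : z • (1 : A) = algebraMap ℝ A z.re := by
  have h1 : star z • (1 : A) = z • (1 : A) := by
    have := h.star_eq
    rwa [star_smul, star_one] at this
  have h2 : star z = z := smul_left_injective ℂ (one_ne_zero (α := A)) h1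
  have h3 : ((z.re : ℝ) : ℂ) = z := Complex.conj_eq_iff_re.1 h2
  rw [Algebra.algebraMap_eq_smul_one]
  conv_lhs => rw [← h3]
  exact Complex.coe_smul _ _

/-- If `P ⊂ A` is an inclusion of simple unital C*-algebras (simple: the only closed
two-sided ideals are `{0}` and the whole algebra) and `E : A → P` is a conditional
expectation (completely positive, contractive, `P`-bimodular, fixing `P`) admitting a
quasi-basis, with Watatani index `Index E = λ • 1` for a real number `λ < 4`, then the
inclusion is irreducible: the relative commutant `P' ∩ A` equals `ℂ • 1`. -/
theorem index_lt_four_implies_irreducible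
    {A : Type*} [CStarAlgebra A] [PartialOrder A] [StarOrderedRing A]
    (hAsimple : ∀ I : TwoSidedIdeal A, IsClosed (I : Set A) → I = ⊥ ∨ I = ⊤)
    (P : StarSubalgebra ℂ A) (hPclosed : IsClosed (P : Set A))
    (hPsimple : ∀ I : TwoSidedIdeal P, IsClosed (I : Set P) → I = ⊥ ∨ I = ⊤)
    (E : A →ₗ[ℂ] A)
    (hrange : ∀ x : A, E x ∈ P)
    (hfix : ∀ p ∈ P, E p = p)
    (hmod : ∀ p ∈ P, ∀ x : A, E (p * x) = p * E x ∧ E (x * p) = E x * p)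
    (hCP : ∀ (k : ℕ) (a b : Fin k → A),
      0 ≤ ∑ i, ∑ j, star (b i) * E (star (a i) * a j) * b j)
    (hcontr : ∀ x : A, ‖E x‖ ≤ ‖x‖)
    {m : ℕ} (u v : Fin m → A)
    (hqb : ∀ a : A, (∑ i, u i * E (v i * a) = a) ∧ (∑ i, E (a * u i) * v i = a))
    (l : ℝ) (hl : l < 4)
    (hindex : ∑ i, u i * v i = (l : ℂ) • (1 : A)) :
    {x : A | ∀ p ∈ P, x * p = p * x} = {x : A | ∃ c : ℂ, x = c • (1 : A)} := by
  have hpos : ∀ x, 0 ≤ x → 0 ≤ E x := by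
    intro x hx
    have h := hCP 1 (fun _ => CFC.sqrt x) (fun _ => 1)
    have hs : star (CFC.sqrt x) = CFC.sqrt x := (IsSelfAdjoint.of_nonneg (CFC.sqrt_nonneg x)).star_eq
    simpa [hs, CFC.sqrt_mul_sqrt_self x hx] using h
  have hstar := map_star_aux E hpos
  rcases subsingleton_or_nontrivial A with hA | hA
  · ext x
    exact ⟨fun _ => ⟨0, Subsingleton.elim _ _⟩, fun _ p _ => Subsingleton.elim _ _⟩
  have hEs : ∀ x, (∀ p ∈ P, x * p = p * x) → ∃ c : ℂ, E x = c • (1 : A) := by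
    intro x hx
    haveI : CompleteSpace P := hPclosed.completeSpace_coe
    obtain ⟨c, hc⟩ := central_scalar_aux hPsimple ⟨E x, hrange x⟩ (by
      rintro ⟨p, hp⟩
      apply Subtype.ext
      change E x * p = p * E x
      rw [← (hmod p hp x).1, ← (hmod p hp x).2, hx p hp])
    exact ⟨c, congrArg Subtype.val hc⟩
  have hFs : ∀ x, (∀ p ∈ P, x * p = p * x) → ∃ c : ℂ, ∑ i, u i * x * v i = c • (1 : A) :=
    fun x hx => central_scalar_aux hAsimple _ (dual_central_aux P E hrange u v hqb x hx)
  have hkey : ∀ g : A, 0 ≤ g → (∀ p ∈ P, g * p = p * g) →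
      0 ≤ E g - g + (1 / 4 : ℂ) • ∑ i, u i * g * v i := by
    intro g hg hgc
    have h := key_ineq_aux P E hrange hmod hstar hCP u v hqb (CFC.sqrt g)
      (IsSelfAdjoint.of_nonneg (CFC.sqrt_nonneg g)).star_eq (fun p hp => by
        have hc : Commute g p := hgc p hp
        rw [CFC.sqrt_eq_cfc]
        exact hc.cfc_nnreal _)
    rwa [CFC.sqrt_mul_sqrt_self g hg] at h
  have hE1 : E 1 = 1 := hfix 1 (one_mem P)
  have hsa : ∀ h : A, IsSelfAdjoint h → (∀ p ∈ P, h * p = p * h) →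
      ∃ c : ℂ, h = c • (1 : A) := by
    intro h hh hhc
    obtain ⟨c, hc⟩ := hEs h hhc
    obtain ⟨d, hd⟩ := hFs h hhc
    have hne : (spectrum ℝ h).Nonempty := ContinuousFunctionalCalculus.spectrum_nonempty h hh
    have hcpt : IsCompact (spectrum ℝ h) := ContinuousFunctionalCalculus.isCompact_spectrum h
    obtain ⟨a, ha, hamin⟩ := hcpt.exists_isLeast hne
    obtain ⟨b, hb, hbmax⟩ := hcpt.exists_isGreatest hne
    have hal : algebraMap ℝ A a ≤ h := algebraMap_le_of_le_spectrum fun x hx => hamin hx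
    have hbl : h ≤ algebraMap ℝ A b := le_algebraMap_of_spectrum_le fun x hx => hbmax hx
    have hre : ∀ r : ℝ, algebraMap ℝ A r = (r : ℂ) • (1 : A) := by
      intro r
      rw [Algebra.algebraMap_eq_smul_one]
      exact (Complex.coe_smul _ _).symm
    rw [hre] at hal hbl
    have hF1 : ∀ r : ℂ, ∑ i, u i * (r • (1 : A)) * v i = (r * l) • (1 : A) := by
      intro r
      simp only [mul_smul_comm, smul_mul_assoc, mul_one, ← Finset.smul_sum, hindex, smul_smul]
    have k1 := hkey _ (sub_nonneg.2 hal) (fun p hp => by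
      simp [sub_mul, mul_sub, hhc p hp])
    have k2 := hkey _ (sub_nonneg.2 hbl) (fun p hp => by
      simp [sub_mul, mul_sub, hhc p hp])
    simp only [mul_sub, sub_mul, Finset.sum_sub_distrib, map_sub, map_smul, hE1, hF1, hc, hd]
      at k1 k2
    have k1' : 0 ≤ (c + (d - a * l) / 4) • (1 : A) - h := by
      convert k1 using 1; module
    have k2' : 0 ≤ h - (c + (d - b * l) / 4) • (1 : A) := by
      convert k2 using 1; module
    have s1 : IsSelfAdjoint ((c + (d - a * l) / 4) • (1 : A)) := by
      simpa using (IsSelfAdjoint.of_nonneg k1').add hh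
    have s2 : IsSelfAdjoint ((c + (d - b * l) / 4) • (1 : A)) := by
      simpa using hh.sub (IsSelfAdjoint.of_nonneg k2')
    rw [real_scalar_aux _ s1, sub_nonneg, le_algebraMap_iff_spectrum_le hh] at k1'
    rw [real_scalar_aux _ s2, sub_nonneg, algebraMap_le_iff_le_spectrum hh] at k2'
    have q1 := k1' b hb
    have q2 := k2' a ha
    have hab : a ≤ b := hamin hb
    have hz : (c + (d - a * l) / 4).re - (c + (d - b * l) / 4).re = (b - a) * l / 4 := by
      rw [← Complex.sub_re]
      have : (c + (d - a * l) / 4) - (c + (d - b * l) / 4) = (((b - a) * l / 4 : ℝ) : ℂ) := by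
        push_cast; ring
      rw [this, Complex.ofReal_re]
    have hba : a = b := by
      by_contra hne'
      have hlt : 0 < b - a := sub_pos.2 (lt_of_le_of_ne hab hne')
      nlinarith
    subst hba
    exact ⟨a, le_antisymm hbl hal⟩
  ext x
  simp only [Set.mem_setOf_eq]
  constructor
  · intro hx
    have hxs : ∀ p ∈ P, star x * p = p * star x := by
      intro p hp
      have := congrArg star (hx (star p) (star_mem hp))
      simpa using this.symm
    obtain ⟨c, hc⟩ := hsa (x + star x) (IsSelfAdjoint.add_star_self x) (fun p hp => by
      rw [add_mul, mul_add, hx p hp, hxs p hp])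
    obtain ⟨d, hd⟩ := hsa (Complex.I • (x - star x)) (by
      rw [IsSelfAdjoint, star_smul, star_sub, star_star]
      simp only [Complex.star_def, Complex.conj_I]
      module) (fun p hp => by
      rw [smul_mul_assoc, mul_smul_comm, sub_mul, mul_sub, hx p hp, hxs p hp])
    refine ⟨(c - Complex.I * d) / 2, ?_⟩
    have e : x = (1 / 2 : ℂ) • ((x + star x) + (-Complex.I) • (Complex.I • (x - star x))) := by
      rw [smul_smul]
      simp only [neg_mul, Complex.I_mul_I, neg_neg, one_smul]
      module
    rw [e, hc, hd]
    module
  · rintro ⟨c, rfl⟩ p hp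
    simp
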